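/- (Representation "B", case 2.) Let 1/2 < ρ ≤ 1 and let μ ∈ ℂ with Re μ < 1 + 1/ρ. Let δ₂ be real with π/(2ρ) < δ₂ < π, and let z = R·exp(iθ) with R > 0 and π/(2ρ) − δ₂ + π < θ < −π/(2ρ) + 2π. Then for every real ε₁ with 0 < ε₁ < 1, E_{ρ,μ}(z) = ∫_{0}^{∞} K′_{ρ,μ}(r, δ₂, z) dr − ∫_{0}^{1−ε₁} K′_{ρ,μ}(r, −π, z) dr − ∫_{1+ε₁}^{∞} K′_{ρ,μ}(r, −π, z) dr + ∫_{−2π}^{−π} P′_{ρ,μ}(ε₁, ψ, −2, z) dψ. -/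

import Mathlib

open scoped Real
open MeasureTheory intervalIntegral

/-- The two-parameter Mittag-Leffler function
`E_{ρ,μ}(z) = ∑_{k=0}^∞ z^k / Γ(μ + k/ρ)`. -/
noncomputable def ML (ρ : ℝ) (μ z : ℂ) : ℂ :=
  ∑' k : ℕ, z ^ k * (Complex.Gamma (μ + (k : ℂ) / (ρ : ℂ)))⁻¹

/-- `φ_{ρ,μ}(ζ,z) = (ρ/(2πi)) exp((ζz)^ρ) (ζz)^{ρ(1-μ)}` at `ζ = r e^{iφ}`,
on the branch fixed by `arg z = θ`, `z = R e^{iθ}`. -/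
noncomputable def phiFun (ρ : ℝ) (μ : ℂ) (R θ r φ : ℝ) : ℂ :=
  ((ρ : ℂ) / (2 * (π : ℂ) * Complex.I)) *
    Complex.exp (Complex.exp ((ρ : ℂ) * ((Real.log (R * r) : ℂ) + Complex.I * ((θ + φ : ℝ) : ℂ)))) *
    Complex.exp ((ρ : ℂ) * (1 - μ) * ((Real.log (R * r) : ℂ) + Complex.I * ((θ + φ : ℝ) : ℂ)))

/-- The (complex-valued) phase function `η(r,φ)`. -/
noncomputable def etaF (ρ : ℝ) (μ : ℂ) (R θ r φ : ℝ) : ℂ :=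
  Complex.exp ((ρ : ℂ) * ((Real.log (R * r) : ℂ) + Complex.I * ((θ - π : ℝ) : ℂ))) *
      Complex.sin ((ρ : ℂ) * (φ : ℂ)) +
    (ρ : ℂ) * (1 - μ) * (φ : ℂ)

/-- The function `A_{ρ,μ}(r,ω₁,ω₂,z)`. -/
noncomputable def AF (ρ : ℝ) (μ : ℂ) (R θ r ω₁ ω₂ : ℝ) : ℂ :=
  Complex.exp (Complex.exp ((ρ : ℂ) * ((Real.log (R * r) : ℂ) + Complex.I * ((θ - π : ℝ) : ℂ))) *
      Complex.cos ((ρ : ℂ) * (ω₁ : ℂ))) *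
    ((r ^ 2 + 2 * r * Real.cos ω₂ + 1 : ℝ) : ℂ) *
    Complex.exp (Complex.I * etaF ρ μ R θ r ω₁) *
    ((r : ℂ) + Complex.exp (Complex.I * (ω₁ : ℂ)))

/-- The kernel `K_{ρ,μ}(r,φ₁,φ₂,z)`. -/
noncomputable def KF (ρ : ℝ) (μ : ℂ) (R θ r φ₁ φ₂ : ℝ) : ℂ :=
  ((ρ : ℂ) / (2 * (π : ℂ) * Complex.I)) *
    Complex.exp ((ρ : ℂ) * (1 - μ) * ((Real.log (R * r) : ℂ) + Complex.I * (θ : ℂ))) *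
    Complex.exp (-(Complex.I * (ρ : ℂ) * (π : ℂ) * (1 - μ))) *
    (AF ρ μ R θ r φ₂ φ₁ - AF ρ μ R θ r φ₁ φ₂) /
    (((r ^ 2 + 2 * r * Real.cos φ₁ + 1 : ℝ) : ℂ) * ((r ^ 2 + 2 * r * Real.cos φ₂ + 1 : ℝ) : ℂ))

/-- The (complex-valued) phase function `χ(r,φ)`. -/
noncomputable def chiF (ρ : ℝ) (μ : ℂ) (R θ r φ : ℝ) : ℂ :=
  Complex.exp ((ρ : ℂ) * ((Real.log (R * r) : ℂ) + Complex.I * (θ : ℂ))) *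
      Complex.sin ((ρ : ℂ) * (φ : ℂ)) +
    (ρ : ℂ) * (1 - μ) * (φ : ℂ)

/-- The kernel `P_{ρ,μ}(r,φ,z)`. -/
noncomputable def PF (ρ : ℝ) (μ : ℂ) (R θ r φ : ℝ) : ℂ :=
  ((ρ : ℂ) / (2 * (π : ℂ))) *
    Complex.exp (Complex.exp ((ρ : ℂ) * ((Real.log (R * r) : ℂ) + Complex.I * (θ : ℂ))) *
      Complex.cos ((ρ : ℂ) * (φ : ℂ))) *
    Complex.exp ((ρ : ℂ) * (1 - μ) * ((Real.log (R * r) : ℂ) + Complex.I * (θ : ℂ))) *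
    Complex.exp (Complex.I * chiF ρ μ R θ r φ) *
    ((r : ℂ) * ((r : ℂ) - Complex.exp (Complex.I * (φ : ℂ)))) /
    ((r ^ 2 - 2 * r * Real.cos φ + 1 : ℝ) : ℂ)

/-- The symmetric kernel `K_{ρ,μ}(r,φ,z)` (case `δ₁ρ = δ₂ρ`). -/
noncomputable def KsymF (ρ : ℝ) (μ : ℂ) (R θ r φ : ℝ) : ℂ :=
  ((ρ : ℂ) / (π : ℂ)) *
    Complex.exp ((ρ : ℂ) * (1 - μ) * ((Real.log (R * r) : ℂ) + Complex.I * ((θ - π : ℝ) : ℂ))) *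
    Complex.exp (Complex.exp ((ρ : ℂ) * ((Real.log (R * r) : ℂ) + Complex.I * ((θ - π : ℝ) : ℂ))) *
      Complex.cos ((ρ : ℂ) * (φ : ℂ))) *
    ((r : ℂ) * Complex.sin (etaF ρ μ R θ r φ) + Complex.sin (etaF ρ μ R θ r φ + (φ : ℂ))) /
    ((r ^ 2 + 2 * r * Real.cos φ + 1 : ℝ) : ℂ)

/-- The kernel `K_{ρ,μ}(r,z)` (case `δρ = π/ρ`). -/
noncomputable def KpiF (ρ : ℝ) (μ : ℂ) (R θ r : ℝ) : ℂ :=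
  ((ρ : ℂ) / (π : ℂ)) *
    Complex.exp ((ρ : ℂ) * (1 - μ) * ((Real.log (R * r) : ℂ) + Complex.I * ((θ - π : ℝ) : ℂ))) *
    Complex.exp (-Complex.exp ((ρ : ℂ) * ((Real.log (R * r) : ℂ) + Complex.I * ((θ - π : ℝ) : ℂ)))) *
    ((r : ℂ) * Complex.sin ((π : ℂ) * (1 - μ)) +
      Complex.sin ((π : ℂ) * (1 - μ) + (π : ℂ) / (ρ : ℂ))) /
    ((r ^ 2 + 2 * r * Real.cos (π / ρ) + 1 : ℝ) : ℂ)

/-- The kernel `K′_{ρ,μ}(r,φ,z)`. -/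
noncomputable def KpF (ρ : ℝ) (μ : ℂ) (R θ r φ : ℝ) : ℂ :=
  ((ρ : ℂ) / (2 * (π : ℂ) * Complex.I)) *
    Complex.exp (Complex.exp ((ρ : ℂ) * ((Real.log (R * r) : ℂ) + Complex.I * ((θ - π : ℝ) : ℂ))) *
      Complex.cos ((ρ : ℂ) * (φ : ℂ))) *
    Complex.exp ((ρ : ℂ) * (1 - μ) * ((Real.log (R * r) : ℂ) + Complex.I * (θ : ℂ))) *
    Complex.exp (Complex.I * (etaF ρ μ R θ r φ - (π : ℂ) * (ρ : ℂ) * (1 - μ))) *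
    ((r : ℂ) + Complex.exp (Complex.I * (φ : ℂ))) /
    ((r ^ 2 + 2 * r * Real.cos φ + 1 : ℝ) : ℂ)

/-- `r(τ,ψ) = √(τ² + 2τ cos ψ + 1)`. -/
noncomputable def rP (τ ψ : ℝ) : ℝ := Real.sqrt (τ ^ 2 + 2 * τ * Real.cos ψ + 1)

/-- `φ(τ,ψ,k) = arctan(τ sin ψ / (τ cos ψ + 1)) + kπ`. -/
noncomputable def phiP (τ ψ : ℝ) (k : ℤ) : ℝ :=
  Real.arctan (τ * Real.sin ψ / (τ * Real.cos ψ + 1)) + k * π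

/-- The (complex-valued) phase `χ′(τ,ψ,k,z)`. -/
noncomputable def chiP (ρ : ℝ) (μ : ℂ) (R θ τ ψ : ℝ) (k : ℤ) : ℂ :=
  Complex.exp ((ρ : ℂ) * ((Real.log (R * rP τ ψ) : ℂ) + Complex.I * (θ : ℂ))) *
      Complex.sin ((ρ : ℂ) * (phiP τ ψ k : ℂ)) +
    (ρ : ℂ) * (1 - μ) * (phiP τ ψ k : ℂ)

/-- The kernel `P′_{ρ,μ}(τ,ψ,k,z)`. -/
noncomputable def PpF (ρ : ℝ) (μ : ℂ) (R θ τ ψ : ℝ) (k : ℤ) : ℂ :=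
  ((ρ * τ : ℝ) : ℂ) / (2 * (π : ℂ)) *
    Complex.exp (Complex.exp ((ρ : ℂ) * ((Real.log (R * rP τ ψ) : ℂ) + Complex.I * (θ : ℂ))) *
      Complex.cos ((ρ : ℂ) * (phiP τ ψ k : ℂ))) *
    Complex.exp ((ρ : ℂ) * (1 - μ) * ((Real.log (R * rP τ ψ) : ℂ) + Complex.I * (θ : ℂ))) *
    Complex.exp (Complex.I * (chiP ρ μ R θ τ ψ k + (ψ : ℂ))) *
    ((rP τ ψ : ℂ) * Complex.exp (-(Complex.I * (phiP τ ψ k : ℂ))) - 1) /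
    ((rP τ ψ ^ 2 - 2 * rP τ ψ * Real.cos (phiP τ ψ k) + 1 : ℝ) : ℂ)

/-- The integrand `exp (e^u + (1 - s) u)` of Hankel's representation of `1 / Γ(s)`,
in the logarithmic coordinate `u`. -/
noncomputable def hankelKernel (s u : ℂ) : ℂ := Complex.exp (Complex.exp u + (1 - s) * u)

lemma differentiable_hankelKernel (s : ℂ) : Differentiable ℂ (hankelKernel s) := by
  unfold hankelKernel; fun_prop

lemma continuous_hankelKernel (s : ℂ) : Continuous (hankelKernel s) :=
  (differentiable_hankelKernel s).continuous

lemma norm_hankelKernel (s : ℂ) (x y : ℝ) :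
    ‖hankelKernel s (x + y * Complex.I)‖ =
      Real.exp (Real.exp x * Real.cos y + (1 - s.re) * x + s.im * y) := by
  rw [hankelKernel, Complex.norm_exp]
  congr 1
  simp [Complex.exp_re]
  ring

lemma neg_mul_exp_add_mul_le {m κ x : ℝ} (hm : 0 < m) (hx : 0 ≤ x) :
    -m * Real.exp x + κ * x ≤ (κ + 1) ^ 2 / (2 * m) - x := by
  have h1 := Real.quadratic_le_exp_of_nonneg hx
  have h2 : m * (1 + x + x ^ 2 / 2) ≤ m * Real.exp x := by gcongr
  have h3 : (κ + 1) * x - m * (x ^ 2 / 2) ≤ (κ + 1) ^ 2 / (2 * m) := by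
    rw [le_div_iff₀ (by positivity)]
    nlinarith [sq_nonneg (m * x - (κ + 1))]
  nlinarith [mul_nonneg hm.le hx]

lemma norm_hankelKernel_le_of_nonneg {s : ℂ} {m x y : ℝ} (hm : 0 < m) (hy : Real.cos y ≤ -m)
    (hx : 0 ≤ x) :
    ‖hankelKernel s (x + y * Complex.I)‖ ≤
      Real.exp ((2 - s.re) ^ 2 / (2 * m) + |s.im| * |y|) * Real.exp (-x) := by
  rw [norm_hankelKernel, ← Real.exp_add]
  apply Real.exp_le_exp.2
  have h1 := neg_mul_exp_add_mul_le (κ := 1 - s.re) hm hx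
  have h2 : s.im * y ≤ |s.im| * |y| := by rw [← abs_mul]; exact le_abs_self _
  have h3 : Real.exp x * Real.cos y ≤ Real.exp x * -m := by gcongr
  have h4 : (1 - s.re + 1) ^ 2 = (2 - s.re) ^ 2 := by ring
  rw [h4] at h1
  linarith

lemma norm_hankelKernel_le (s : ℂ) (x y : ℝ) :
    ‖hankelKernel s (x + y * Complex.I)‖ ≤
      Real.exp (Real.exp x + |s.im| * |y|) * Real.exp ((1 - s.re) * x) := by
  rw [norm_hankelKernel, ← Real.exp_add]
  apply Real.exp_le_exp.2
  have h2 : s.im * y ≤ |s.im| * |y| := by rw [← abs_mul]; exact le_abs_self _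
  have h3 : Real.exp x * Real.cos y ≤ Real.exp x * 1 := by
    gcongr; exact Real.cos_le_one y
  linarith

lemma integrableOn_hankelKernel_Ioi (s : ℂ) {b : ℝ} (hb : Real.cos b < 0) (c : ℝ) :
    IntegrableOn (fun x : ℝ ↦ hankelKernel s (x + b * Complex.I)) (Set.Ioi c) := by
  have hc : Continuous (fun x : ℝ ↦ hankelKernel s (x + b * Complex.I)) :=
    (continuous_hankelKernel s).comp (by fun_prop)
  refine (integrable_norm_iff hc.aestronglyMeasurable).1 ?_
  refine integrable_of_isBigO_exp_neg one_pos hc.norm.continuousOn ?_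
  refine Asymptotics.IsBigO.of_bound
    (Real.exp ((2 - s.re) ^ 2 / (2 * -Real.cos b) + |s.im| * |b|)) ?_
  filter_upwards [Filter.eventually_ge_atTop 0] with x hx
  have := norm_hankelKernel_le_of_nonneg (s := s) (m := -Real.cos b) (y := b) (by linarith)
    (by simp) hx
  simpa using this

lemma integrable_hankelKernel {s : ℂ} (hs : s.re < 1) {b : ℝ} (hb : Real.cos b < 0) :
    Integrable (fun x : ℝ ↦ hankelKernel s (x + b * Complex.I)) := by
  have hc : Continuous (fun x : ℝ ↦ hankelKernel s (x + b * Complex.I)) :=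
    (continuous_hankelKernel s).comp (by fun_prop)
  rw [← integrableOn_univ, ← Set.Iic_union_Ioi (a := (0 : ℝ))]
  refine IntegrableOn.union ?_ (integrableOn_hankelKernel_Ioi s hb 0)
  refine Integrable.mono' (g := fun x ↦ Real.exp (1 + |s.im| * |b|) * Real.exp ((1 - s.re) * x))
    ((integrableOn_exp_mul_Iic (by linarith) 0).const_mul _) hc.aestronglyMeasurable ?_
  refine (ae_restrict_iff' measurableSet_Iic).2 (.of_forall fun x hx ↦ ?_)
  refine (norm_hankelKernel_le s x b).trans ?_
  gcongr
  simpa using hx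

/-- The integral of `g` over the contour that comes from `+∞ + ia` to `c + ia`, goes up to `c + ib`
and then to `+∞ + ib`. -/
noncomputable def hankelIntegral (g : ℂ → ℂ) (a b c : ℝ) : ℂ :=
  (∫ x in Set.Ioi c, g (x + b * Complex.I)) - (∫ x in Set.Ioi c, g (x + a * Complex.I)) +
    Complex.I * ∫ y in a..b, g (c + y * Complex.I)

lemma hankelIntegral_eq_of_differentiable {g : ℂ → ℂ} (hg : Differentiable ℂ g) {a b : ℝ}
    (ha : ∀ c, IntegrableOn (fun x : ℝ ↦ g (x + a * Complex.I)) (Set.Ioi c))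
    (hb : ∀ c, IntegrableOn (fun x : ℝ ↦ g (x + b * Complex.I)) (Set.Ioi c)) (c c' : ℝ) :
    hankelIntegral g a b c = hankelIntegral g a b c' := by
  have h := Complex.integral_boundary_rect_eq_zero_of_differentiableOn g ⟨c, a⟩ ⟨c', b⟩
    hg.differentiableOn
  have h1 := integral_Ioi_sub_Ioi' (ha c) (ha c')
  have h2 := integral_Ioi_sub_Ioi' (hb c) (hb c')
  simp only [smul_eq_mul] at h
  rw [← h1, ← h2] at h
  rw [hankelIntegral, hankelIntegral]
  linear_combination -h

lemma norm_intervalIntegral_hankelKernel_le (s : ℂ) (a b x : ℝ) :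
    ‖∫ y in a..b, hankelKernel s (x + y * Complex.I)‖ ≤
      Real.exp (Real.exp x + |s.im| * max |a| |b|) * Real.exp ((1 - s.re) * x) * |b - a| := by
  refine norm_integral_le_of_norm_le_const fun y hy ↦ (norm_hankelKernel_le s x y).trans ?_
  have : |y| ≤ max |a| |b| := by
    have h := Set.uIoc_subset_uIcc hy
    rw [Set.mem_uIcc] at h
    rcases h with h | h
    · exact abs_le_max_abs_abs h.1 h.2
    · rw [max_comm]; exact abs_le_max_abs_abs h.1 h.2
  gcongr

lemma tendsto_intervalIntegral_hankelKernel_atBot {s : ℂ} (hs : s.re < 1) (a b : ℝ) :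
    Filter.Tendsto (fun x : ℝ ↦ ∫ y in a..b, hankelKernel s (x + y * Complex.I))
      Filter.atBot (nhds 0) := by
  refine squeeze_zero_norm (fun x ↦ norm_intervalIntegral_hankelKernel_le s a b x) ?_
  have h1 : Filter.Tendsto (fun x ↦ Real.exp (Real.exp x + |s.im| * max |a| |b|)) Filter.atBot
      (nhds (Real.exp (0 + |s.im| * max |a| |b|))) :=
    Real.continuous_exp.continuousAt.tendsto.comp (Real.tendsto_exp_atBot.add_const _)
  have h2 : Filter.Tendsto (fun x ↦ Real.exp ((1 - s.re) * x)) Filter.atBot (nhds 0) :=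
    Real.tendsto_exp_atBot.comp (Filter.tendsto_id.const_mul_atBot (by linarith))
  simpa using (h1.mul h2).mul_const |b - a|

lemma tendsto_intervalIntegral_hankelKernel_atTop (s : ℂ) {a b : ℝ}
    (hab : ∀ y ∈ Set.uIcc a b, Real.cos y < 0) :
    Filter.Tendsto (fun x : ℝ ↦ ∫ y in a..b, hankelKernel s (x + y * Complex.I))
      Filter.atTop (nhds 0) := by
  obtain ⟨y₀, hy₀, hmax⟩ := (isCompact_uIcc (a := a) (b := b)).exists_isMaxOn
    Set.nonempty_uIcc Real.continuous_cos.continuousOn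
  have hm : 0 < -Real.cos y₀ := neg_pos.2 (hab y₀ hy₀)
  refine squeeze_zero_norm' (a := fun x ↦ Real.exp ((2 - s.re) ^ 2 / (2 * -Real.cos y₀) +
    |s.im| * max |a| |b|) * Real.exp (-x) * |b - a|) ?_ ?_
  · filter_upwards [Filter.eventually_ge_atTop 0] with x hx
    refine norm_integral_le_of_norm_le_const fun y hy ↦ ?_
    have h := Set.uIoc_subset_uIcc hy
    refine (norm_hankelKernel_le_of_nonneg (s := s) hm (y := y) ?_ hx).trans ?_
    · simpa using hmax h
    have : |y| ≤ max |a| |b| := by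
      rw [Set.mem_uIcc] at h
      rcases h with h | h
      · exact abs_le_max_abs_abs h.1 h.2
      · rw [max_comm]; exact abs_le_max_abs_abs h.1 h.2
    gcongr
  · have := ((Real.tendsto_exp_neg_atTop_nhds_zero).const_mul
      (Real.exp ((2 - s.re) ^ 2 / (2 * -Real.cos y₀) + |s.im| * max |a| |b|))).mul_const |b - a|
    simpa using this

lemma integral_hankelKernel_eq {s : ℂ} (hs : s.re < 1) {a b : ℝ}
    (hab : ∀ y ∈ Set.uIcc a b, Real.cos y < 0) :
    ∫ x : ℝ, hankelKernel s (x + a * Complex.I) = ∫ x : ℝ, hankelKernel s (x + b * Complex.I) := by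
  have ha := integrable_hankelKernel hs (hab a Set.left_mem_uIcc)
  have hb := integrable_hankelKernel hs (hab b Set.right_mem_uIcc)
  have h (x : ℝ) := Complex.integral_boundary_rect_eq_zero_of_differentiableOn (hankelKernel s)
    ⟨-x, a⟩ ⟨x, b⟩ (differentiable_hankelKernel s).differentiableOn
  have hA := intervalIntegral_tendsto_integral ha Filter.tendsto_neg_atTop_atBot Filter.tendsto_id
  have hB := intervalIntegral_tendsto_integral hb Filter.tendsto_neg_atTop_atBot Filter.tendsto_id
  have hR := (tendsto_intervalIntegral_hankelKernel_atTop s hab).const_mul Complex.I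
  have hL := ((tendsto_intervalIntegral_hankelKernel_atBot hs a b).comp
    Filter.tendsto_neg_atTop_atBot).const_mul Complex.I
  have hlim := ((hA.sub hB).add hR).sub hL
  have h0 := tendsto_nhds_unique (hlim.congr fun x ↦ by simpa using h x) tendsto_const_nhds
  simpa [sub_eq_zero] using h0

lemma integral_exp_neg_exp_add_mul {κ : ℂ} (hκ : 0 < κ.re) :
    ∫ x : ℝ, Complex.exp (-Complex.exp x + κ * x) = Complex.Gamma κ := by
  rw [Complex.Gamma_eq_integral hκ, Complex.GammaIntegral]
  have h := integral_image_eq_integral_abs_deriv_smul MeasurableSet.univ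
    (fun x _ ↦ (Real.hasDerivAt_exp x).hasDerivWithinAt) Real.exp_injective.injOn
    (fun t : ℝ ↦ (Real.exp (-t) : ℂ) * (t : ℂ) ^ (κ - 1))
  rw [Set.image_univ, Real.range_exp] at h
  rw [h, setIntegral_univ]
  refine integral_congr_ae (.of_forall fun x ↦ ?_)
  simp only [abs_of_pos (Real.exp_pos x), Complex.real_smul]
  rw [Complex.cpow_def_of_ne_zero (by simp [Complex.exp_ne_zero]), ← Complex.ofReal_log (Real.exp_pos x).le,
    Real.log_exp]
  push_cast
  rw [← Complex.exp_add, ← Complex.exp_add]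
  ring_nf

lemma hankelKernel_add_pi_mul_I (s : ℂ) (x : ℝ) :
    hankelKernel s (x + (π : ℝ) * Complex.I) =
      Complex.exp ((1 - s) * π * Complex.I) * Complex.exp (-Complex.exp x + (1 - s) * x) := by
  rw [hankelKernel, Complex.exp_add (x : ℂ), Complex.exp_pi_mul_I, ← Complex.exp_add]
  ring_nf

lemma hankelKernel_add_neg_pi_mul_I (s : ℂ) (x : ℝ) :
    hankelKernel s (x + (-π : ℝ) * Complex.I) =
      Complex.exp (-((1 - s) * π * Complex.I)) * Complex.exp (-Complex.exp x + (1 - s) * x) := by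
  have : Complex.exp (((-π : ℝ) : ℂ) * Complex.I) = -1 := by
    push_cast
    rw [neg_mul, Complex.exp_neg, Complex.exp_pi_mul_I]
    norm_num
  rw [hankelKernel, Complex.exp_add (x : ℂ), this, ← Complex.exp_add]
  push_cast
  ring_nf

lemma cos_neg_of_mem_uIcc_pi {b y : ℝ} (hb : b ∈ Set.Ioo (π / 2) (3 * π / 2))
    (hy : y ∈ Set.uIcc b π) : Real.cos y < 0 := by
  have := Real.pi_pos
  rw [Set.mem_uIcc] at hy
  obtain ⟨h1, h2⟩ := hb
  apply Real.cos_neg_of_pi_div_two_lt_of_lt <;> rcases hy with h | h <;> linarith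

lemma cos_neg_of_mem_uIcc_neg_pi {a y : ℝ} (ha : a ∈ Set.Ioo (-(3 * π / 2)) (-(π / 2)))
    (hy : y ∈ Set.uIcc a (-π)) : Real.cos y < 0 := by
  rw [← Real.cos_neg]
  refine cos_neg_of_mem_uIcc_pi (b := -a) ⟨by linarith [ha.2], by linarith [ha.1]⟩ ?_
  rw [Set.mem_uIcc] at hy ⊢
  rcases hy with h | h
  · right; constructor <;> linarith
  · left; constructor <;> linarith

lemma hankelIntegral_hankelKernel_of_re_lt_one {s : ℂ} (hs : s.re < 1) {a b : ℝ}
    (ha : a ∈ Set.Ioo (-(3 * π / 2)) (-(π / 2))) (hb : b ∈ Set.Ioo (π / 2) (3 * π / 2)) (c : ℝ) :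
    hankelIntegral (hankelKernel s) a b c = 2 * π * Complex.I * (Complex.Gamma s)⁻¹ := by
  have ha' : ∀ y ∈ Set.uIcc a (-π), Real.cos y < 0 := fun y ↦ cos_neg_of_mem_uIcc_neg_pi ha
  have hb' : ∀ y ∈ Set.uIcc b π, Real.cos y < 0 := fun y ↦ cos_neg_of_mem_uIcc_pi hb
  have hκ : 0 < (1 - s).re := by simpa using hs
  have hA := (aecover_Ioi (μ := volume) Filter.tendsto_id).integral_tendsto_of_countably_generated
    (integrable_hankelKernel hs (ha' a Set.left_mem_uIcc))
  have hB := (aecover_Ioi (μ := volume) Filter.tendsto_id).integral_tendsto_of_countably_generated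
    (integrable_hankelKernel hs (hb' b Set.left_mem_uIcc))
  have hV := (tendsto_intervalIntegral_hankelKernel_atBot hs a b).const_mul Complex.I
  have hlim := (hB.sub hA).add hV
  have h0 := tendsto_nhds_unique (hlim.congr fun x ↦
    hankelIntegral_eq_of_differentiable (differentiable_hankelKernel s)
      (integrableOn_hankelKernel_Ioi s (ha' a Set.left_mem_uIcc))
      (integrableOn_hankelKernel_Ioi s (hb' b Set.left_mem_uIcc)) x c) tendsto_const_nhds
  rw [← h0, integral_hankelKernel_eq hs ha', integral_hankelKernel_eq hs hb']
  simp_rw [hankelKernel_add_pi_mul_I, hankelKernel_add_neg_pi_mul_I]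
  rw [MeasureTheory.integral_const_mul, MeasureTheory.integral_const_mul, integral_exp_neg_exp_add_mul hκ]
  have hG := Complex.Gamma_mul_Gamma_one_sub (1 - s)
  rw [sub_sub_cancel] at hG
  have hsin : Complex.exp ((1 - s) * π * Complex.I) - Complex.exp (-((1 - s) * π * Complex.I)) =
      2 * Complex.I * Complex.sin (π * (1 - s)) := by
    rw [Complex.sin, neg_mul, mul_comm (π : ℂ)]
    linear_combination (Complex.exp ((1 - s) * π * Complex.I) -
      Complex.exp (-((1 - s) * π * Complex.I))) * Complex.I_sq
  have hΓ : Complex.Gamma (1 - s) * Complex.sin (π * (1 - s)) = π * (Complex.Gamma s)⁻¹ := by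
    have hne := Complex.Gamma_ne_zero_of_re_pos hκ
    have hπ : (π : ℂ) ≠ 0 := by exact_mod_cast Real.pi_ne_zero
    by_cases h : Complex.sin (π * (1 - s)) = 0
    · rw [h, div_zero] at hG
      rcases mul_eq_zero.1 hG with h' | h'
      · exact absurd h' hne
      · simp [h, h']
    · have : Complex.Gamma s ≠ 0 := by
        intro h'
        rw [h', mul_zero] at hG
        exact div_ne_zero hπ h hG.symm
      rw [eq_div_iff h] at hG
      rw [← div_eq_mul_inv, eq_div_iff this]
      linear_combination hG
  linear_combination Complex.Gamma (1 - s) * hsin + 2 * Complex.I * hΓ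

lemma hankelIntegral_deriv_eq_zero {g g' : ℂ → ℂ} (hg : ∀ u, HasDerivAt g (g' u) u)
    (hg' : Continuous g') {a b c : ℝ}
    (ha : IntegrableOn (fun x : ℝ ↦ g' (x + a * Complex.I)) (Set.Ioi c))
    (hb : IntegrableOn (fun x : ℝ ↦ g' (x + b * Complex.I)) (Set.Ioi c))
    (ha0 : Filter.Tendsto (fun x : ℝ ↦ g (x + a * Complex.I)) Filter.atTop (nhds 0))
    (hb0 : Filter.Tendsto (fun x : ℝ ↦ g (x + b * Complex.I)) Filter.atTop (nhds 0)) :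
    hankelIntegral g' a b c = 0 := by
  have hH (y x : ℝ) : HasDerivAt (fun x : ℝ ↦ g (x + y * Complex.I)) (g' (x + y * Complex.I)) x := by
    simpa using ((hg (x + y * Complex.I)).comp (x : ℂ)
      ((hasDerivAt_id (x : ℂ)).add_const (y * Complex.I))).comp_ofReal
  have hV (y : ℝ) : HasDerivAt (fun y : ℝ ↦ g (c + y * Complex.I))
      (Complex.I * g' (c + y * Complex.I)) y := by
    have : HasDerivAt (fun y : ℂ ↦ c + y * Complex.I) Complex.I (y : ℂ) := by
      simpa using ((hasDerivAt_id (y : ℂ)).mul_const Complex.I).const_add (c : ℂ)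
    simpa [mul_comm] using ((hg (c + y * Complex.I)).comp (y : ℂ) this).comp_ofReal
  rw [hankelIntegral, integral_Ioi_of_hasDerivAt_of_tendsto' (fun x _ ↦ hH a x) ha ha0,
    integral_Ioi_of_hasDerivAt_of_tendsto' (fun x _ ↦ hH b x) hb hb0,
    ← intervalIntegral.integral_const_mul,
    integral_eq_sub_of_hasDerivAt (fun y _ ↦ hV y)]
  · ring
  · exact Continuous.intervalIntegrable (by fun_prop) _ _

lemma hankelIntegral_sub {f g : ℂ → ℂ} (hf : Continuous f) (hg : Continuous g) {a b c : ℝ}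
    (hfa : IntegrableOn (fun x : ℝ ↦ f (x + a * Complex.I)) (Set.Ioi c))
    (hfb : IntegrableOn (fun x : ℝ ↦ f (x + b * Complex.I)) (Set.Ioi c))
    (hga : IntegrableOn (fun x : ℝ ↦ g (x + a * Complex.I)) (Set.Ioi c))
    (hgb : IntegrableOn (fun x : ℝ ↦ g (x + b * Complex.I)) (Set.Ioi c)) :
    hankelIntegral (fun u ↦ f u - g u) a b c = hankelIntegral f a b c - hankelIntegral g a b c := by
  simp only [hankelIntegral]
  rw [integral_sub hfa hga, integral_sub hfb hgb, intervalIntegral.integral_sub]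
  · ring
  · exact Continuous.intervalIntegrable (by fun_prop) _ _
  · exact Continuous.intervalIntegrable (by fun_prop) _ _

lemma hankelIntegral_const_mul (k : ℂ) (g : ℂ → ℂ) (a b c : ℝ) :
    hankelIntegral (fun u ↦ k * g u) a b c = k * hankelIntegral g a b c := by
  simp only [hankelIntegral, MeasureTheory.integral_const_mul, intervalIntegral.integral_const_mul]
  ring

lemma tendsto_hankelKernel_atTop (s : ℂ) {b : ℝ} (hb : Real.cos b < 0) :
    Filter.Tendsto (fun x : ℝ ↦ hankelKernel s (x + b * Complex.I)) Filter.atTop (nhds 0) := by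
  refine squeeze_zero_norm' (a := fun x ↦ Real.exp ((2 - s.re) ^ 2 / (2 * -Real.cos b) +
    |s.im| * |b|) * Real.exp (-x)) ?_ ?_
  · filter_upwards [Filter.eventually_ge_atTop 0] with x hx
    exact norm_hankelKernel_le_of_nonneg (neg_pos.2 hb) (by simp) hx
  · simpa using Real.tendsto_exp_neg_atTop_nhds_zero.const_mul
      (Real.exp ((2 - s.re) ^ 2 / (2 * -Real.cos b) + |s.im| * |b|))

lemma hankelIntegral_hankelKernel_eq_mul (s : ℂ) {a b : ℝ} (ha : Real.cos a < 0)
    (hb : Real.cos b < 0) (c : ℝ) :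
    hankelIntegral (hankelKernel s) a b c = s * hankelIntegral (hankelKernel (s + 1)) a b c := by
  have hd (u : ℂ) : HasDerivAt (hankelKernel (s + 1))
      (hankelKernel s u - s * hankelKernel (s + 1) u) u := by
    have h := ((Complex.hasDerivAt_exp u).add ((hasDerivAt_id u).const_mul (1 - (s + 1)))).cexp
    refine h.congr_deriv ?_
    have : hankelKernel s u = Complex.exp u * hankelKernel (s + 1) u := by
      simp only [hankelKernel]
      rw [← Complex.exp_add]
      ring_nf
    rw [this]
    simp [hankelKernel]
    ring
  have hia := integrableOn_hankelKernel_Ioi s ha c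
  have hib := integrableOn_hankelKernel_Ioi s hb c
  have hia' := (integrableOn_hankelKernel_Ioi (s + 1) ha c).const_mul s
  have hib' := (integrableOn_hankelKernel_Ioi (s + 1) hb c).const_mul s
  have hc := continuous_hankelKernel s
  have hc' := (continuous_hankelKernel (s + 1)).const_mul s
  have h := hankelIntegral_deriv_eq_zero hd (hc.sub hc') (hia.sub hia') (hib.sub hib')
    (tendsto_hankelKernel_atTop _ ha) (tendsto_hankelKernel_atTop _ hb)
  rw [hankelIntegral_sub hc hc' hia hib hia' hib', hankelIntegral_const_mul] at h
  exact sub_eq_zero.1 h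

lemma continuous_uncurry_hankelKernel : Continuous (Function.uncurry hankelKernel) := by
  unfold hankelKernel Function.uncurry; fun_prop

lemma continuous_integral_hankelKernel_Ioi {b : ℝ} (hb : Real.cos b < 0) :
    Continuous fun s : ℂ ↦ ∫ x in Set.Ioi (0 : ℝ), hankelKernel s (x + b * Complex.I) := by
  refine continuous_iff_continuousAt.2 fun s₀ ↦ ?_
  set K : ℝ := ((|2 - s₀.re| + 1) ^ 2 / (2 * -Real.cos b) + (|s₀.im| + 1) * |b|) with hK
  refine continuousAt_of_dominated (bound := fun x ↦ Real.exp K * Real.exp (-x)) ?_ ?_ ?_ ?_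
  · refine .of_forall fun s ↦ Continuous.aestronglyMeasurable ?_
    exact (continuous_hankelKernel s).comp (by fun_prop)
  · filter_upwards [Metric.ball_mem_nhds s₀ one_pos] with s hs
    refine (ae_restrict_iff' measurableSet_Ioi).2 (.of_forall fun x hx ↦ ?_)
    refine (norm_hankelKernel_le_of_nonneg (m := -Real.cos b) (neg_pos.2 hb) (by simp)
      (le_of_lt hx)).trans ?_
    rw [mem_ball_iff_norm] at hs
    have hre : |s.re - s₀.re| ≤ 1 := by
      simpa using (Complex.abs_re_le_norm (s - s₀)).trans hs.le
    have him : |s.im - s₀.im| ≤ 1 := by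
      simpa using (Complex.abs_im_le_norm (s - s₀)).trans hs.le
    have h1 : (2 - s.re) ^ 2 ≤ (|2 - s₀.re| + 1) ^ 2 := by
      refine sq_le_sq' ?_ ?_ <;> rw [abs_le] at hre <;>
        linarith [le_abs_self (2 - s₀.re), neg_abs_le (2 - s₀.re)]
    have h2 : |s.im| ≤ |s₀.im| + 1 := by
      have := abs_sub_abs_le_abs_sub s.im s₀.im
      linarith
    rw [hK]
    have : 0 < -Real.cos b := neg_pos.2 hb
    gcongr
  · exact (integrableOn_exp_neg_Ioi 0).const_mul _
  · refine .of_forall fun x ↦ Continuous.continuousAt ?_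
    exact continuous_uncurry_hankelKernel.comp (by fun_prop : Continuous fun s : ℂ ↦
      (s, (x + b * Complex.I : ℂ)))

lemma continuous_hankelIntegral_hankelKernel {a b : ℝ} (ha : Real.cos a < 0)
    (hb : Real.cos b < 0) :
    Continuous fun s : ℂ ↦ hankelIntegral (hankelKernel s) a b 0 := by
  have hV : Continuous fun s : ℂ ↦ ∫ y in a..b, hankelKernel s ((0 : ℝ) + y * Complex.I) := by
    refine continuous_parametric_intervalIntegral_of_continuous' ?_ a b
    exact continuous_uncurry_hankelKernel.comp (by fun_prop : Continuous fun p : ℂ × ℝ ↦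
      (p.1, ((0 : ℝ) + p.2 * Complex.I : ℂ)))
  exact ((continuous_integral_hankelKernel_Ioi hb).sub (continuous_integral_hankelKernel_Ioi ha)).add
    (hV.const_mul Complex.I)

/-- Hankel's contour integral for `1 / Γ(s)`. -/
theorem hankelIntegral_hankelKernel (s : ℂ) {a b : ℝ}
    (ha : a ∈ Set.Ioo (-(3 * π / 2)) (-(π / 2))) (hb : b ∈ Set.Ioo (π / 2) (3 * π / 2)) (c : ℝ) :
    hankelIntegral (hankelKernel s) a b c = 2 * π * Complex.I * (Complex.Gamma s)⁻¹ := by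
  have ha' := cos_neg_of_mem_uIcc_neg_pi ha Set.left_mem_uIcc
  have hb' := cos_neg_of_mem_uIcc_pi hb Set.left_mem_uIcc
  have hone : hankelIntegral (hankelKernel 1) a b 0 =
      2 * π * Complex.I * (Complex.Gamma 1)⁻¹ := by
    have hu : Filter.Tendsto (fun t : ℝ ↦ (t : ℂ)) (nhdsWithin 1 (Set.Iio 1)) (nhds 1) :=
      (Complex.continuous_ofReal.tendsto' 1 1 (by simp)).mono_left nhdsWithin_le_nhds
    have h1 := ((continuous_hankelIntegral_hankelKernel ha' hb').tendsto 1).comp hu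
    have h2 := (((Complex.differentiable_one_div_Gamma.continuous).const_mul
      (2 * π * Complex.I)).tendsto 1).comp hu
    refine tendsto_nhds_unique (h1.congr' ?_) h2
    filter_upwards [self_mem_nhdsWithin] with t ht
    exact hankelIntegral_hankelKernel_of_re_lt_one (by simpa using ht) ha hb 0
  rw [hankelIntegral_eq_of_differentiable (differentiable_hankelKernel s)
    (integrableOn_hankelKernel_Ioi s ha') (integrableOn_hankelKernel_Ioi s hb') c 0]
  have key (n : ℕ) : ∀ s : ℂ, s.re < n + 1 →
      hankelIntegral (hankelKernel s) a b 0 = 2 * π * Complex.I * (Complex.Gamma s)⁻¹ := by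
    induction n with
    | zero =>
      intro s hs
      exact hankelIntegral_hankelKernel_of_re_lt_one (by simpa using hs) ha hb 0
    | succ n ih =>
      intro s hs
      by_cases h1 : s = 1
      · rw [h1, hone]
      have hne : s - 1 ≠ 0 := sub_ne_zero.2 h1
      have h := hankelIntegral_hankelKernel_eq_mul (s - 1) ha' hb' 0
      have hΓ := Complex.one_div_Gamma_eq_self_mul_one_div_Gamma_add_one (s - 1)
      rw [sub_add_cancel] at h hΓ
      rw [ih (s - 1) (by push_cast at hs; simp; linarith), hΓ] at h
      exact mul_left_cancel₀ hne (by rw [← h]; ring)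
  obtain ⟨n, hn⟩ := exists_nat_gt s.re
  exact key n s (by linarith)

/-- The Hankel kernel in the coordinate `v = log ζ`, where `u = ρ (ℓ + v)` and `ℓ = log z`. -/
noncomputable def scaledKernel (ρ : ℝ) (ℓ s v : ℂ) : ℂ := hankelKernel s (ρ * (ℓ + v))

lemma differentiable_scaledKernel (ρ : ℝ) (ℓ s : ℂ) : Differentiable ℂ (scaledKernel ρ ℓ s) :=
  (differentiable_hankelKernel s).comp (by fun_prop)

lemma scaledKernel_add_mul_I (ρ : ℝ) (ℓ s : ℂ) (x y : ℝ) :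
    scaledKernel ρ ℓ s (x + y * Complex.I) =
      hankelKernel s ((ρ * (ℓ.re + x) : ℝ) + (ρ * (ℓ.im + y) : ℝ) * Complex.I) := by
  rw [scaledKernel]
  nth_rw 1 [← Complex.re_add_im ℓ]
  push_cast
  ring_nf

lemma image_mul_add_Ioi {ρ : ℝ} (hρ : 0 < ρ) (p c : ℝ) :
    (fun x : ℝ ↦ ρ * (p + x)) '' Set.Ioi c = Set.Ioi (ρ * (p + c)) := by
  ext y
  simp only [Set.mem_image, Set.mem_Ioi]
  constructor
  · rintro ⟨x, hx, rfl⟩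
    gcongr
  · intro hy
    refine ⟨y / ρ - p, ?_, by field_simp; ring⟩
    rw [lt_sub_iff_add_lt', lt_div_iff₀ hρ]
    linarith

lemma hasDerivAt_mul_add (ρ p x : ℝ) : HasDerivAt (fun x : ℝ ↦ ρ * (p + x)) ρ x := by
  simpa using ((hasDerivAt_id x).const_add p).const_mul ρ

lemma injective_mul_add {ρ : ℝ} (hρ : 0 < ρ) (p : ℝ) :
    Function.Injective (fun x : ℝ ↦ ρ * (p + x)) :=
  fun _ _ h ↦ add_left_cancel (mul_left_cancel₀ hρ.ne' h)

lemma integrableOn_scaledKernel_Ioi {ρ : ℝ} (hρ : 0 < ρ) (ℓ s : ℂ) {b : ℝ}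
    (hb : Real.cos (ρ * (ℓ.im + b)) < 0) (c : ℝ) :
    IntegrableOn (fun x : ℝ ↦ scaledKernel ρ ℓ s (x + b * Complex.I)) (Set.Ioi c) := by
  simp only [scaledKernel_add_mul_I]
  have h := integrableOn_hankelKernel_Ioi s hb (ρ * (ℓ.re + c))
  rw [← image_mul_add_Ioi hρ, integrableOn_image_iff_integrableOn_abs_deriv_smul measurableSet_Ioi
    (fun x _ ↦ (hasDerivAt_mul_add ρ ℓ.re x).hasDerivWithinAt) (injective_mul_add hρ _).injOn] at h
  refine IntegrableOn.congr_fun (h.smul ρ⁻¹) (fun x _ ↦ ?_) measurableSet_Ioi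
  simp only [Pi.smul_apply, abs_of_pos hρ, smul_smul]
  rw [inv_mul_cancel₀ hρ.ne', one_smul]

lemma integrable_scaledKernel {ρ : ℝ} (hρ : 0 < ρ) (ℓ : ℂ) {s : ℂ} (hs : s.re < 1) {b : ℝ}
    (hb : Real.cos (ρ * (ℓ.im + b)) < 0) :
    Integrable (fun x : ℝ ↦ scaledKernel ρ ℓ s (x + b * Complex.I)) := by
  simp only [scaledKernel_add_mul_I]
  exact ((integrable_hankelKernel hs hb).comp_mul_left' hρ.ne').comp_add_left ℓ.re

lemma integral_scaledKernel_Ioi {ρ : ℝ} (hρ : 0 < ρ) (ℓ s : ℂ) (b c : ℝ) :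
    ∫ x in Set.Ioi c, scaledKernel ρ ℓ s (x + b * Complex.I) =
      (ρ : ℂ)⁻¹ * ∫ x in Set.Ioi (ρ * (ℓ.re + c)),
        hankelKernel s (x + (ρ * (ℓ.im + b) : ℝ) * Complex.I) := by
  simp only [scaledKernel_add_mul_I]
  rw [← image_mul_add_Ioi hρ, integral_image_eq_integral_abs_deriv_smul measurableSet_Ioi
    (fun x _ ↦ (hasDerivAt_mul_add ρ ℓ.re x).hasDerivWithinAt) (injective_mul_add hρ _).injOn]
  simp only [abs_of_pos hρ]
  rw [MeasureTheory.integral_smul, Complex.real_smul, inv_mul_cancel_left₀ (by exact_mod_cast hρ.ne')]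

lemma hankelIntegral_scaledKernel_eq {ρ : ℝ} (hρ : 0 < ρ) (ℓ s : ℂ) (a b c : ℝ) :
    hankelIntegral (scaledKernel ρ ℓ s) a b c =
      (ρ : ℂ)⁻¹ * hankelIntegral (hankelKernel s) (ρ * (ℓ.im + a)) (ρ * (ℓ.im + b))
        (ρ * (ℓ.re + c)) := by
  have h := intervalIntegral.integral_comp_add_mul (a := a) (b := b)
    (fun y : ℝ ↦ hankelKernel s ((ρ * (ℓ.re + c) : ℝ) + y * Complex.I)) hρ.ne' (ρ * ℓ.im)
  simp only [← mul_add] at h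
  rw [hankelIntegral, hankelIntegral, integral_scaledKernel_Ioi hρ, integral_scaledKernel_Ioi hρ]
  simp only [scaledKernel_add_mul_I]
  rw [h, Complex.real_smul, Complex.ofReal_inv]
  ring

lemma hankelIntegral_scaledKernel {ρ : ℝ} (hρ : 0 < ρ) (ℓ s : ℂ) {a b : ℝ}
    (ha : ρ * (ℓ.im + a) ∈ Set.Ioo (-(3 * π / 2)) (-(π / 2)))
    (hb : ρ * (ℓ.im + b) ∈ Set.Ioo (π / 2) (3 * π / 2)) (c : ℝ) :
    hankelIntegral (scaledKernel ρ ℓ s) a b c =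
      2 * π * Complex.I / ρ * (Complex.Gamma s)⁻¹ := by
  rw [hankelIntegral_scaledKernel_eq hρ, hankelIntegral_hankelKernel s ha hb]
  ring

lemma scaledKernel_add_div {ρ : ℝ} (hρ : 0 < ρ) (ℓ s v : ℂ) (k : ℕ) :
    Complex.exp ℓ ^ k * scaledKernel ρ ℓ (s + k / ρ) v =
      scaledKernel ρ ℓ s v * Complex.exp (-v) ^ k := by
  have : (ρ : ℂ) ≠ 0 := by exact_mod_cast hρ.ne'
  rw [scaledKernel, scaledKernel, hankelKernel, hankelKernel, ← Complex.exp_nat_mul,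
    ← Complex.exp_nat_mul, ← Complex.exp_add, ← Complex.exp_add]
  congr 1
  field_simp
  ring

lemma hasSum_integral_mul_pow {α : Type*} [MeasurableSpace α] {ν : Measure α} {g w : α → ℂ}
    (hg : Integrable g ν) (hw : AEStronglyMeasurable w ν) {q : ℝ} (hq0 : 0 ≤ q) (hq : q < 1)
    (hwq : ∀ᵐ x ∂ν, ‖w x‖ ≤ q) :
    HasSum (fun k : ℕ ↦ ∫ x, g x * w x ^ k ∂ν) (∫ x, g x * (1 - w x)⁻¹ ∂ν) := by
  have hb (k : ℕ) : ∀ᵐ x ∂ν, ‖w x ^ k‖ ≤ q ^ k := hwq.mono fun x hx ↦ by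
    rw [norm_pow]; gcongr
  have hint (k : ℕ) : Integrable (fun x ↦ g x * w x ^ k) ν := hg.mul_bdd (hw.pow k) (hb k)
  have hsum : Summable fun k : ℕ ↦ ∫ x, ‖g x * w x ^ k‖ ∂ν := by
    refine Summable.of_nonneg_of_le (fun k ↦ integral_nonneg fun _ ↦ norm_nonneg _) (fun k ↦ ?_)
      ((summable_geometric_of_lt_one hq0 hq).mul_left (∫ x, ‖g x‖ ∂ν))
    rw [← MeasureTheory.integral_mul_const]
    refine integral_mono_ae (hint k).norm (hg.norm.mul_const _) ?_
    filter_upwards [hb k] with x hx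
    rw [norm_mul]
    gcongr
  have h := hasSum_integral_of_summable_integral_norm hint hsum
  rwa [integral_congr_ae (g := fun x ↦ g x * (1 - w x)⁻¹)] at h
  filter_upwards [hwq] with x hx
  rw [tsum_mul_left, tsum_geometric_of_norm_lt_one (hx.trans_lt hq)]

lemma norm_exp_neg_add_mul_I (x y : ℝ) :
    ‖Complex.exp (-(x + y * Complex.I))‖ = Real.exp (-x) := by
  simp [Complex.norm_exp]

lemma hasSum_hankelIntegral_mul_exp_neg_pow {g : ℂ → ℂ} (hg : Continuous g) {a b c : ℝ}
    (hc : 0 < c) (ha : IntegrableOn (fun x : ℝ ↦ g (x + a * Complex.I)) (Set.Ioi c))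
    (hb : IntegrableOn (fun x : ℝ ↦ g (x + b * Complex.I)) (Set.Ioi c)) (hab : a ≤ b) :
    HasSum (fun k : ℕ ↦ hankelIntegral (fun v ↦ g v * Complex.exp (-v) ^ k) a b c)
      (hankelIntegral (fun v ↦ g v * (1 - Complex.exp (-v))⁻¹) a b c) := by
  have hq0 := (Real.exp_pos (-c)).le
  have hq : Real.exp (-c) < 1 := by simpa using hc
  have hray {y : ℝ} (h : IntegrableOn (fun x : ℝ ↦ g (x + y * Complex.I)) (Set.Ioi c)) :=
    hasSum_integral_mul_pow (w := fun x : ℝ ↦ Complex.exp (-(x + y * Complex.I))) h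
      (Continuous.aestronglyMeasurable (by fun_prop)) hq0 hq
      ((ae_restrict_mem measurableSet_Ioi).mono fun x hx ↦ by
        rw [norm_exp_neg_add_mul_I]
        exact Real.exp_le_exp.2 (neg_le_neg (le_of_lt hx)))
  have hv := hasSum_integral_mul_pow (ν := volume.restrict (Set.Ioc a b))
    (g := fun y : ℝ ↦ g (c + y * Complex.I))
    (w := fun y : ℝ ↦ Complex.exp (-(c + y * Complex.I)))
    ((Continuous.intervalIntegrable (by fun_prop) a b).1)
    (Continuous.aestronglyMeasurable (by fun_prop)) hq0 hq
    (.of_forall fun y ↦ (norm_exp_neg_add_mul_I c y).le)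
  simp only [hankelIntegral, intervalIntegral.integral_of_le hab]
  exact ((hray hb).sub (hray ha)).add (hv.mul_left Complex.I)

/-- The Mittag-Leffler series as a contour integral in the coordinate `v = log ζ`. -/
theorem hasSum_mittagLeffler {ρ : ℝ} (hρ : 0 < ρ) (ℓ s : ℂ) {a b c : ℝ} (hc : 0 < c)
    (ha : ρ * (ℓ.im + a) ∈ Set.Ioo (-(3 * π / 2)) (-(π / 2)))
    (hb : ρ * (ℓ.im + b) ∈ Set.Ioo (π / 2) (3 * π / 2)) :
    HasSum (fun k : ℕ ↦ Complex.exp ℓ ^ k * (Complex.Gamma (s + k / ρ))⁻¹)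
      (ρ / (2 * π * Complex.I) * hankelIntegral
        (fun v ↦ scaledKernel ρ ℓ s v * (1 - Complex.exp (-v))⁻¹) a b c) := by
  have hab : a ≤ b := by
    have := lt_of_mul_lt_mul_left ((ha.2.trans (by linarith [Real.pi_pos])).trans hb.1) hρ.le
    linarith
  have hca := cos_neg_of_mem_uIcc_neg_pi ha Set.left_mem_uIcc
  have hcb := cos_neg_of_mem_uIcc_pi hb Set.left_mem_uIcc
  have h := (hasSum_hankelIntegral_mul_exp_neg_pow (differentiable_scaledKernel ρ ℓ s).continuous hc
    (integrableOn_scaledKernel_Ioi hρ ℓ s hca c) (integrableOn_scaledKernel_Ioi hρ ℓ s hcb c)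
    hab).mul_left (ρ / (2 * π * Complex.I) : ℂ)
  convert! h using 2 with k
  simp only [← scaledKernel_add_div hρ]
  rw [hankelIntegral_const_mul, hankelIntegral_scaledKernel hρ ℓ _ ha hb]
  have h1 : (ρ : ℂ) ≠ 0 := by exact_mod_cast hρ.ne'
  have h2 : (π : ℂ) ≠ 0 := by exact_mod_cast Real.pi_ne_zero
  have h3 := Complex.I_ne_zero
  generalize (Complex.Gamma (s + k / ρ))⁻¹ = y
  field_simp

lemma exp_neg_ne_one {v : ℂ} (h1 : -(4 * π) < v.im) (h2 : v.im < 0)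
    (h3 : v ≠ -(2 * π * Complex.I)) : 1 - Complex.exp (-v) ≠ 0 := by
  intro h
  obtain ⟨n, hn⟩ := Complex.exp_eq_one_iff.1 (sub_eq_zero.1 h).symm
  have him : -v.im = n * (2 * π) := by simpa using congrArg Complex.im hn
  have hπ := Real.pi_pos
  have hn1 : (0 : ℝ) < n := by nlinarith
  have hn2 : (n : ℝ) < 2 := by nlinarith
  have hn3 : n = 1 := by
    have : 0 < n := by exact_mod_cast hn1
    have : n < 2 := by exact_mod_cast hn2
    omega
  rw [hn3] at hn
  exact h3 (by linear_combination (-1 : ℂ) * hn)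

lemma convex_strip (a b : ℝ) : Convex ℝ {v : ℂ | a < v.im ∧ v.im < b} :=
  (convex_halfSpace_im_gt a).inter (convex_halfSpace_im_lt b)

lemma isOpen_strip (a b : ℝ) : IsOpen {v : ℂ | a < v.im ∧ v.im < b} :=
  (isOpen_lt continuous_const Complex.continuous_im).inter
    (isOpen_lt Complex.continuous_im continuous_const)

/-- A primitive, above the ray from `-2πi`, of a function with a simple pole at `-2πi`. -/
lemma exists_primitive_mul_inv_one_sub_exp_neg {G : ℂ → ℂ} (hG : Differentiable ℂ G) :
    ∃ Φ : ℂ → ℂ, ∀ v : ℂ, -(2 * π) ≤ v.im → v.im < 0 → v ≠ -(2 * π * Complex.I) →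
      HasDerivAt Φ (G v * (1 - Complex.exp (-v))⁻¹) v := by
  set p : ℂ := -(2 * π * Complex.I) with hp
  set S : Set ℂ := {v : ℂ | -(4 * π) < v.im ∧ v.im < 0}
  have hπ := Real.pi_pos
  have hpS : p ∈ S := by
    constructor <;> simp [hp] <;> linarith
  have hS : S ∈ nhds p := (isOpen_strip _ _).mem_nhds hpS
  set h : ℂ → ℂ := fun v ↦ 1 - Complex.exp (-v) with hh
  have hexp : Complex.exp (-p) = 1 := by rw [hp, neg_neg, Complex.exp_two_pi_mul_I]
  have hhp : h p = 0 := by rw [hh]; simp [hexp]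
  have hdh : HasDerivAt h 1 p := by
    have := ((hasDerivAt_neg p).cexp).const_sub 1
    simpa [hexp] using this
  have hD : DifferentiableOn ℂ (dslope h p) S :=
    (Complex.differentiableOn_dslope hS).2 (by fun_prop)
  have hD0 : ∀ v ∈ S, dslope h p v ≠ 0 := fun v hv ↦ by
    by_cases hvp : v = p
    · rw [hvp, dslope_same, hdh.deriv]; exact one_ne_zero
    · rw [dslope_of_ne _ hvp, slope_def_field, hhp, sub_zero]
      exact div_ne_zero (exp_neg_ne_one hv.1 hv.2 hvp) (sub_ne_zero.2 hvp)
  set N : ℂ → ℂ := fun v ↦ G v / dslope h p v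
  have hN : DifferentiableOn ℂ N S := hG.differentiableOn.div hD hD0
  obtain ⟨Φ, hΦ⟩ := (convex_strip _ _).exists_forall_hasDerivWithinAt
    ((Complex.differentiableOn_dslope hS).2 hN)
  refine ⟨fun v ↦ Φ v + N p * Complex.log (-Complex.I * (v - p)), fun v hv1 hv2 hvp ↦ ?_⟩
  have hvS : v ∈ S := ⟨by linarith, hv2⟩
  have hvp' : v - p ≠ 0 := sub_ne_zero.2 hvp
  have hslit : -Complex.I * (v - p) ∈ Complex.slitPlane := by
    rw [Complex.mem_slitPlane_iff]
    have hre : (-Complex.I * (v - p)).re = v.im + 2 * π := by simp [hp]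
    have him : (-Complex.I * (v - p)).im = -v.re := by simp [hp]
    rw [hre, him]
    by_cases h0 : v.im = -(2 * π)
    · right
      intro h1
      refine hvp (Complex.ext ?_ ?_)
      · simp [hp]; linarith
      · simp [hp, h0]
    · left
      have := lt_of_le_of_ne hv1 (Ne.symm h0)
      linarith
  have h1 := (hΦ v hvS).hasDerivAt ((isOpen_strip _ _).mem_nhds hvS)
  have h2 := (((((hasDerivAt_id v).sub_const p).const_mul (-Complex.I)).clog hslit).const_mul (N p))
  convert! h1.add h2 using 1
  have hNv : G v * (h v)⁻¹ = N v / (v - p) := by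
    simp only [N]
    rw [dslope_of_ne _ hvp, slope_def_field, hhp, sub_zero]
    have := exp_neg_ne_one hvS.1 hvS.2 hvp
    field_simp
  rw [hNv, dslope_of_ne _ hvp, slope_def_field]
  have := Complex.I_ne_zero
  simp only [id]
  field_simp
  ring

/-- The point `log (1 + ε e^{iψ}) - 2πi` of the detour around the pole `-2πi`. -/
noncomputable def detour (ε ψ : ℝ) : ℂ :=
  Complex.log (1 + ε * Complex.exp (ψ * Complex.I)) - 2 * π * Complex.I

lemma re_one_add_mul_exp_pos {ε : ℝ} (hε0 : 0 < ε) (hε : ε < 1) (ψ : ℝ) :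
    0 < (1 + ε * Complex.exp (ψ * Complex.I)).re := by
  have : (1 + ε * Complex.exp (ψ * Complex.I)).re = 1 + ε * Real.cos ψ := by
    simp [Complex.exp_ofReal_mul_I_re]
  rw [this]
  nlinarith [Real.neg_one_le_cos ψ]

lemma exp_detour {ε : ℝ} (hε0 : 0 < ε) (hε : ε < 1) (ψ : ℝ) :
    Complex.exp (detour ε ψ) = 1 + ε * Complex.exp (ψ * Complex.I) := by
  rw [detour, Complex.exp_sub, Complex.exp_two_pi_mul_I, div_one, Complex.exp_log]
  intro h
  simpa [h] using re_one_add_mul_exp_pos hε0 hε ψ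

lemma one_sub_exp_neg_detour {ε : ℝ} (hε0 : 0 < ε) (hε : ε < 1) (ψ : ℝ) :
    1 - Complex.exp (-detour ε ψ) =
      ε * Complex.exp (ψ * Complex.I) / (1 + ε * Complex.exp (ψ * Complex.I)) := by
  rw [Complex.exp_neg, exp_detour hε0 hε, eq_div_iff, sub_mul, inv_mul_cancel₀]
  · ring
  all_goals
    intro h
    simpa [h] using re_one_add_mul_exp_pos hε0 hε ψ

lemma hasDerivAt_detour {ε : ℝ} (hε0 : 0 < ε) (hε : ε < 1) (ψ : ℝ) :
    HasDerivAt (detour ε)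
      (Complex.I * (1 - Complex.exp (-detour ε ψ))) ψ := by
  rw [one_sub_exp_neg_detour hε0 hε]
  have h1 : HasDerivAt (fun ψ : ℝ ↦ 1 + ε * Complex.exp (ψ * Complex.I))
      (ε * (Complex.exp (ψ * Complex.I) * (1 * Complex.I))) ψ :=
    ((((hasDerivAt_id ψ).ofReal_comp.mul_const Complex.I).cexp).const_mul (ε : ℂ)).const_add 1
  refine ((h1.clog_real (.inl (re_one_add_mul_exp_pos hε0 hε ψ))).sub_const _).congr_deriv ?_
  ring

lemma detour_ne {ε : ℝ} (hε0 : 0 < ε) (hε : ε < 1) (ψ : ℝ) :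
    detour ε ψ ≠ -(2 * π * Complex.I) := by
  intro h
  have := exp_detour hε0 hε ψ
  rw [h, Complex.exp_neg, Complex.exp_two_pi_mul_I, inv_one] at this
  have h1 : (ε : ℂ) * Complex.exp (ψ * Complex.I) = 0 := by linear_combination -this
  simp [Complex.exp_ne_zero, hε0.ne'] at h1

lemma detour_im (ε ψ : ℝ) :
    (detour ε ψ).im = (1 + ε * Complex.exp (ψ * Complex.I)).arg - 2 * π := by
  simp [detour, Complex.log_im]

lemma detour_im_neg (ε ψ : ℝ) : (detour ε ψ).im < 0 := by
  rw [detour_im]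
  linarith [Complex.arg_le_pi (1 + ε * Complex.exp (ψ * Complex.I)), Real.pi_pos]

lemma neg_two_pi_le_detour_im {ε : ℝ} (hε0 : 0 < ε) {ψ : ℝ} (hψ : 0 ≤ Real.sin ψ) :
    -(2 * π) ≤ (detour ε ψ).im := by
  rw [detour_im, neg_le_sub_iff_le_add, le_add_iff_nonneg_left, Complex.arg_nonneg_iff]
  simpa [Complex.exp_ofReal_mul_I_im] using by positivity

lemma detour_neg_two_pi {ε : ℝ} (hε0 : 0 < ε) :
    detour ε (-(2 * π)) = Real.log (1 + ε) + (-(2 * π) : ℝ) * Complex.I := by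
  rw [detour, Complex.ofReal_log (by linarith)]
  push_cast
  rw [neg_mul, Complex.exp_neg, Complex.exp_two_pi_mul_I]
  simp
  ring

lemma detour_neg_pi {ε : ℝ} (hε : ε < 1) :
    detour ε (-π) = Real.log (1 - ε) + (-(2 * π) : ℝ) * Complex.I := by
  rw [detour, Complex.ofReal_log (by linarith)]
  push_cast
  rw [neg_mul, Complex.exp_neg, Complex.exp_pi_mul_I]
  norm_num
  ring_nf

/-- The integrand `g(v) / (1 - e^{-v})`, with poles at the multiples of `2πi`. -/
noncomputable def poleKernel (g : ℂ → ℂ) (v : ℂ) : ℂ := g v * (1 - Complex.exp (-v))⁻¹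

lemma add_mul_I_ne_neg_two_pi_mul_I {x y : ℝ} (h : x ≠ 0 ∨ y ≠ -(2 * π)) :
    (x + y * Complex.I : ℂ) ≠ -(2 * π * Complex.I) := by
  intro h'
  have h1 : x = 0 := by simpa using congrArg Complex.re h'
  have h2 : y = -(2 * π) := by simpa using congrArg Complex.im h'
  tauto

lemma continuousAt_poleKernel {g : ℂ → ℂ} (hg : Continuous g) {x y : ℝ} (h1 : -(2 * π) ≤ y)
    (h2 : y < 0) (h : x ≠ 0 ∨ y ≠ -(2 * π)) :
    ContinuousAt (poleKernel g) (x + y * Complex.I) := by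
  have hne := exp_neg_ne_one (v := x + y * Complex.I) (by simp; linarith [Real.pi_pos]) (by simpa)
    (add_mul_I_ne_neg_two_pi_mul_I h)
  exact hg.continuousAt.mul (ContinuousAt.inv₀ (by fun_prop) hne)

/-- Deformation of the vertical segment on `Re v = log (1 + ε)`. -/
lemma I_mul_integral_poleKernel_eq {G : ℂ → ℂ} (hG : Differentiable ℂ G) {ε b m : ℝ}
    (hε0 : 0 < ε) (hε : ε < 1) (hb1 : -(2 * π) < b) (hb2 : b < 0)
    (hm : m ≤ Real.log (1 - ε)) :
    Complex.I * ∫ y in -(2 * π)..b, poleKernel G (Real.log (1 + ε) + y * Complex.I) =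
      (∫ x in m..Real.log (1 + ε), poleKernel G (x + b * Complex.I)) -
      (∫ x in m..Real.log (1 - ε), poleKernel G (x + (-(2 * π) : ℝ) * Complex.I)) +
      Complex.I * (∫ ψ in -(2 * π)..-π, G (detour ε ψ)) +
      Complex.I * ∫ y in -(2 * π)..b, poleKernel G (m + y * Complex.I) := by
  obtain ⟨Φ, hΦ⟩ := exists_primitive_mul_inv_one_sub_exp_neg hG
  have hπ := Real.pi_pos
  have hd : Real.log (1 - ε) < 0 := Real.log_neg (by linarith) (by linarith)
  have hc : 0 < Real.log (1 + ε) := Real.log_pos (by linarith)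
  have hderiv {x y : ℝ} (h1 : -(2 * π) ≤ y) (h2 : y < 0) (h : x ≠ 0 ∨ y ≠ -(2 * π)) :
      HasDerivAt Φ (poleKernel G (x + y * Complex.I)) (x + y * Complex.I) :=
    hΦ _ (by simpa) (by simpa) (add_mul_I_ne_neg_two_pi_mul_I h)
  have hor {x₁ x₂ y : ℝ} (h1 : -(2 * π) ≤ y) (h2 : y < 0)
      (h : ∀ x ∈ Set.uIcc x₁ x₂, x ≠ 0 ∨ y ≠ -(2 * π)) :
      ∫ x in x₁..x₂, poleKernel G (x + y * Complex.I) =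
        Φ (x₂ + y * Complex.I) - Φ (x₁ + y * Complex.I) := by
    refine integral_eq_sub_of_hasDerivAt (f := fun x : ℝ ↦ Φ (x + y * Complex.I)) (fun x hx ↦ ?_)
      (ContinuousOn.intervalIntegrable fun x hx ↦ ContinuousAt.continuousWithinAt ?_)
    · have := (hderiv h1 h2 (h x hx)).scomp x
        ((Complex.ofRealCLM.hasDerivAt (x := x)).add_const (y * Complex.I))
      simpa [Function.comp_def] using this
    · exact (continuousAt_poleKernel hG.continuous h1 h2 (h x hx)).comp
        (f := fun x : ℝ ↦ (x + y * Complex.I : ℂ)) (by fun_prop)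
  have ver {x : ℝ} (h : x ≠ 0) :
      Complex.I * ∫ y in -(2 * π)..b, poleKernel G (x + y * Complex.I) =
        Φ (x + b * Complex.I) - Φ (x + (-(2 * π) : ℝ) * Complex.I) := by
    have hy {y : ℝ} (hy : y ∈ Set.uIcc (-(2 * π)) b) : -(2 * π) ≤ y ∧ y < 0 := by
      rw [Set.uIcc_of_le hb1.le] at hy
      exact ⟨hy.1, hy.2.trans_lt hb2⟩
    rw [← intervalIntegral.integral_const_mul]
    refine integral_eq_sub_of_hasDerivAt (f := fun y : ℝ ↦ Φ (x + y * Complex.I)) (fun y hy' ↦ ?_)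
      (ContinuousOn.intervalIntegrable fun y hy' ↦ ContinuousAt.continuousWithinAt ?_)
    · have := (hderiv (hy hy').1 (hy hy').2 (.inl h)).scomp y
        (((Complex.ofRealCLM.hasDerivAt (x := y)).mul_const Complex.I).const_add (x : ℂ))
      simpa [Function.comp_def] using this
    · exact continuousAt_const.mul ((continuousAt_poleKernel hG.continuous (hy hy').1 (hy hy').2
        (.inl h)).comp (f := fun y : ℝ ↦ (x + y * Complex.I : ℂ)) (by fun_prop))
  have hdet : Complex.I * (∫ ψ in -(2 * π)..-π, G (detour ε ψ)) =
      Φ (Real.log (1 - ε) + (-(2 * π) : ℝ) * Complex.I) -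
        Φ (Real.log (1 + ε) + (-(2 * π) : ℝ) * Complex.I) := by
    rw [← detour_neg_pi hε, ← detour_neg_two_pi hε0, ← intervalIntegral.integral_const_mul]
    have hcont : Continuous (detour ε) :=
      continuous_iff_continuousAt.2 fun ψ ↦ (hasDerivAt_detour hε0 hε ψ).continuousAt
    refine integral_eq_sub_of_hasDerivAt (f := fun ψ : ℝ ↦ Φ (detour ε ψ)) (fun ψ hψ ↦ ?_)
      (Continuous.intervalIntegrable (continuous_const.mul (hG.continuous.comp hcont)) _ _)
    rw [Set.uIcc_of_le (by linarith)] at hψ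
    have hsin : 0 ≤ Real.sin ψ := by
      rw [← Real.sin_add_two_pi]
      exact Real.sin_nonneg_of_nonneg_of_le_pi (by linarith [hψ.1]) (by linarith [hψ.2])
    have hne := detour_ne hε0 hε ψ
    have him := neg_two_pi_le_detour_im hε0 hsin
    have := (hΦ _ him (detour_im_neg ε ψ) hne).scomp ψ (hasDerivAt_detour hε0 hε ψ)
    refine this.congr_deriv ?_
    have h0 := exp_neg_ne_one (by linarith) (detour_im_neg ε ψ) hne
    rw [smul_eq_mul]
    field_simp
  rw [ver hc.ne', ver (hm.trans_lt hd).ne, hdet, hor hb1.le hb2 fun _ _ ↦ .inr hb1.ne',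
    hor le_rfl (by linarith) fun x hx ↦ .inl ?_]
  · ring
  · rw [Set.uIcc_of_le hm] at hx
    exact (hx.2.trans_lt hd).ne

lemma poleKernel_scaledKernel {ρ : ℝ} (hρ : 0 < ρ) (ℓ s v : ℂ) :
    poleKernel (scaledKernel ρ ℓ s) v =
      Complex.exp (-ℓ) * (scaledKernel ρ ℓ (s - 1 / ρ) v * (Complex.exp v - 1)⁻¹) := by
  have h := scaledKernel_add_div hρ ℓ (s - 1 / ρ) v 1
  have h1 : 1 - Complex.exp (-v) = (Complex.exp v - 1) * Complex.exp (-v) := by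
    rw [sub_mul, ← Complex.exp_add, add_neg_cancel, Complex.exp_zero, one_mul]
  rw [Nat.cast_one, sub_add_cancel, pow_one, pow_one] at h
  have h2 : scaledKernel ρ ℓ s v =
      Complex.exp (-ℓ) * (scaledKernel ρ ℓ (s - 1 / ρ) v * Complex.exp (-v)) := by
    rw [← h, ← mul_assoc, ← Complex.exp_add, neg_add_cancel, Complex.exp_zero, one_mul]
  have h3 := Complex.exp_ne_zero (-v)
  rw [poleKernel, h1, mul_inv, h2]
  field_simp

lemma integrableOn_poleKernel_scaledKernel {ρ : ℝ} (hρ : 0 < ρ) (ℓ : ℂ) {s : ℂ}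
    (hs : s.re < 1 + 1 / ρ) {b : ℝ} (hb : Real.cos (ρ * (ℓ.im + b)) < 0) {t : Set ℝ}
    (ht : MeasurableSet t) {δ : ℝ} (hδ : 0 < δ)
    (h : ∀ x ∈ t, δ ≤ ‖Complex.exp (x + b * Complex.I) - 1‖) :
    IntegrableOn (fun x : ℝ ↦ poleKernel (scaledKernel ρ ℓ s) (x + b * Complex.I)) t := by
  have hs' : (s - 1 / ρ).re < 1 := by
    have : (s - 1 / ρ).re = s.re - 1 / ρ := by
      rw [Complex.sub_re, ← Complex.ofReal_one, ← Complex.ofReal_div, Complex.ofReal_re]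
    linarith
  simp only [poleKernel_scaledKernel hρ]
  refine Integrable.const_mul ((integrable_scaledKernel hρ ℓ hs' hb).integrableOn.mul_bdd
    (c := δ⁻¹) (Measurable.aestronglyMeasurable (by fun_prop)) ?_) _
  filter_upwards [ae_restrict_mem ht] with x hx
  rw [norm_inv]
  exact inv_anti₀ hδ (h x hx)

lemma abs_sin_le_norm_exp_sub_one (x y : ℝ) :
    |Real.sin y| ≤ ‖Complex.exp (x + y * Complex.I) - 1‖ := by
  have h1 : Complex.exp (x + y * Complex.I) - 1 =
      Complex.exp (y * Complex.I) * (Real.exp x - Complex.exp ((-y : ℝ) * Complex.I)) := by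
    rw [mul_sub, ← Complex.exp_add, Complex.exp_add]
    push_cast
    ring_nf
    rw [Complex.exp_zero]
    ring
  rw [h1, norm_mul, Complex.norm_exp_ofReal_mul_I, one_mul]
  refine le_trans (le_of_eq ?_) (Complex.abs_im_le_norm _)
  rw [Complex.sub_im, Complex.exp_ofReal_mul_I_im, Complex.ofReal_im, Real.sin_neg, zero_sub,
    neg_neg]

lemma le_norm_exp_sub_one {ε x y : ℝ} (hε : ε < 1) (hx : x ≤ Real.log (1 - ε)) :
    ε ≤ ‖Complex.exp (x + y * Complex.I) - 1‖ := by
  have h1 : Real.exp x ≤ 1 - ε := (Real.le_log_iff_exp_le (by linarith)).1 hx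
  have h2 := norm_sub_norm_le 1 (Complex.exp (x + y * Complex.I))
  rw [norm_sub_rev, norm_one, Complex.norm_exp] at h2
  simp at h2
  linarith

lemma tendsto_integral_poleKernel_scaledKernel {ρ : ℝ} (hρ : 0 < ρ) (ℓ : ℂ) {s : ℂ}
    (hs : s.re < 1 + 1 / ρ) (a b : ℝ) :
    Filter.Tendsto (fun x : ℝ ↦ ∫ y in a..b, poleKernel (scaledKernel ρ ℓ s) (x + y * Complex.I))
      Filter.atBot (nhds 0) := by
  set s' : ℂ := s - 1 / ρ with hs'
  have hs1 : s'.re < 1 := by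
    have : s'.re = s.re - 1 / ρ := by
      rw [hs', Complex.sub_re, ← Complex.ofReal_one, ← Complex.ofReal_div, Complex.ofReal_re]
    linarith
  set B := max |ρ * (ℓ.im + a)| |ρ * (ℓ.im + b)|
  have hlim : Filter.Tendsto (fun x ↦ ρ * (ℓ.re + x)) Filter.atBot Filter.atBot :=
    (Filter.tendsto_atBot_add_const_left _ _ Filter.tendsto_id).const_mul_atBot hρ
  have h1 : Filter.Tendsto (fun x ↦ Real.exp (Real.exp x + |s'.im| * B)) Filter.atBot
      (nhds (Real.exp (0 + |s'.im| * B))) :=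
    Real.continuous_exp.continuousAt.tendsto.comp (Real.tendsto_exp_atBot.add_const _)
  have h2 : Filter.Tendsto (fun x ↦ Real.exp ((1 - s'.re) * x)) Filter.atBot (nhds 0) :=
    Real.tendsto_exp_atBot.comp (Filter.tendsto_id.const_mul_atBot (by linarith))
  have h3 := ((((h1.mul h2).comp hlim).mul_const (1 / 2 : ℝ)⁻¹).const_mul
    ‖Complex.exp (-ℓ)‖).mul_const |b - a|
  rw [mul_zero, zero_mul, mul_zero, zero_mul] at h3
  refine squeeze_zero_norm' ?_ h3
  filter_upwards [Filter.eventually_le_atBot (Real.log (1 - 1 / 2))] with x hx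
  refine norm_integral_le_of_norm_le_const fun y hy ↦ ?_
  have hyB : |ρ * (ℓ.im + y)| ≤ B := by
    have h := Set.uIoc_subset_uIcc hy
    rw [Set.mem_uIcc] at h
    rcases h with h | h
    · exact abs_le_max_abs_abs (by nlinarith) (by nlinarith)
    · exact (abs_le_max_abs_abs (a := ρ * (ℓ.im + b)) (c := ρ * (ℓ.im + a)) (by nlinarith)
        (by nlinarith)).trans_eq (max_comm _ _)
  rw [poleKernel_scaledKernel hρ, norm_mul, norm_mul, norm_inv, scaledKernel_add_mul_I]
  refine mul_le_mul_of_nonneg_left (mul_le_mul ?_ ?_ (by positivity)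
    (by simp only [Function.comp]; positivity))
    (norm_nonneg _)
  · refine (norm_hankelKernel_le _ _ _).trans ?_
    simp only [Function.comp]
    gcongr
  · exact inv_anti₀ (by norm_num) (le_norm_exp_sub_one (by norm_num) hx)

/-- Deformation of the contour to the boundary of the left half-strip, with a detour around
`-2πi`. -/
theorem hankelIntegral_poleKernel_eq {ρ : ℝ} (hρ : 0 < ρ) (ℓ : ℂ) {s : ℂ}
    (hs : s.re < 1 + 1 / ρ) {ε b : ℝ} (hε0 : 0 < ε) (hε : ε < 1) (hb1 : -π < b) (hb2 : b < 0)
    (hca : Real.cos (ρ * (ℓ.im + -(2 * π))) < 0) (hcb : Real.cos (ρ * (ℓ.im + b)) < 0) :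
    hankelIntegral (poleKernel (scaledKernel ρ ℓ s)) (-(2 * π)) b (Real.log (1 + ε)) =
      (∫ x : ℝ, poleKernel (scaledKernel ρ ℓ s) (x + b * Complex.I)) -
      (∫ x in Set.Iic (Real.log (1 - ε)),
        poleKernel (scaledKernel ρ ℓ s) (x + (-(2 * π) : ℝ) * Complex.I)) -
      (∫ x in Set.Ioi (Real.log (1 + ε)),
        poleKernel (scaledKernel ρ ℓ s) (x + (-(2 * π) : ℝ) * Complex.I)) +
      Complex.I * ∫ ψ in -(2 * π)..-π, scaledKernel ρ ℓ s (detour ε ψ) := by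
  have hπ := Real.pi_pos
  have hIb := integrableOn_poleKernel_scaledKernel hρ ℓ hs hcb MeasurableSet.univ
    (abs_pos.2 (Real.sin_neg_of_neg_of_neg_pi_lt hb2 hb1).ne)
    (fun x _ ↦ abs_sin_le_norm_exp_sub_one x b)
  have hIa := integrableOn_poleKernel_scaledKernel hρ ℓ hs hca measurableSet_Iic hε0
    (t := Set.Iic (Real.log (1 - ε))) (fun x hx ↦ le_norm_exp_sub_one hε hx)
  rw [integrableOn_univ] at hIb
  have h1 := intervalIntegral_tendsto_integral_Iic (Real.log (1 + ε)) hIb.integrableOn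
    Filter.tendsto_id
  have h2 := intervalIntegral_tendsto_integral_Iic (Real.log (1 - ε)) hIa Filter.tendsto_id
  have h3 := (tendsto_integral_poleKernel_scaledKernel hρ ℓ hs (-(2 * π)) b).const_mul Complex.I
  have h4 := ((h1.sub h2).add_const
    (Complex.I * ∫ ψ in -(2 * π)..-π, scaledKernel ρ ℓ s (detour ε ψ))).add h3
  have h5 : ∀ᶠ m in Filter.atBot, m ≤ Real.log (1 - ε) := Filter.eventually_le_atBot _
  have h6 := tendsto_nhds_unique (tendsto_const_nhds.congr' (h5.mono fun m hm ↦
    I_mul_integral_poleKernel_eq (differentiable_scaledKernel ρ ℓ s) hε0 hε (by linarith)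
      hb2 hm)) h4
  rw [hankelIntegral, h6, ← integral_Iic_add_Ioi (b := Real.log (1 + ε)) hIb.integrableOn
    hIb.integrableOn]
  ring

lemma scaledKernel_eq_exp_mul_exp (ρ : ℝ) (ℓ s w u : ℂ) :
    Complex.exp (Complex.exp (ρ * (ℓ + w)) * Complex.cos (ρ * u)) *
        Complex.exp (ρ * (1 - s) * (ℓ + w)) *
        Complex.exp (Complex.I * (Complex.exp (ρ * (ℓ + w)) * Complex.sin (ρ * u) +
          ρ * (1 - s) * u)) =
      scaledKernel ρ ℓ s (w + u * Complex.I) := by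
  have h : Complex.exp (ρ * (ℓ + (w + u * Complex.I))) =
      Complex.exp (ρ * (ℓ + w)) * (Complex.cos (ρ * u) + Complex.sin (ρ * u) * Complex.I) := by
    rw [← Complex.exp_mul_I, ← Complex.exp_add]
    ring_nf
  rw [scaledKernel, hankelKernel, h, ← Complex.exp_add, ← Complex.exp_add]
  ring_nf

lemma add_exp_I_div_eq (r φ : ℝ) :
    ((r : ℂ) + Complex.exp (Complex.I * φ)) / ((r ^ 2 + 2 * r * Real.cos φ + 1 : ℝ) : ℂ) =
      ((r : ℂ) + Complex.exp (-(Complex.I * φ)))⁻¹ := by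
  have h1 : ((r : ℂ) + Complex.exp (-(Complex.I * φ))) =
      (starRingEnd ℂ) ((r : ℂ) + Complex.exp (Complex.I * φ)) := by
    rw [map_add, ← Complex.exp_conj, map_mul, Complex.conj_I, Complex.conj_ofReal,
      Complex.conj_ofReal, neg_mul]
  have h2 : ((r ^ 2 + 2 * r * Real.cos φ + 1 : ℝ) : ℂ) =
      ((r : ℂ) + Complex.exp (Complex.I * φ)) * ((r : ℂ) + Complex.exp (-(Complex.I * φ))) := by
    have h3 : Complex.exp (Complex.I * φ) * Complex.exp (-(Complex.I * φ)) = 1 := by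
      rw [← Complex.exp_add, add_neg_cancel, Complex.exp_zero]
    have h4 := Complex.two_cos (φ : ℂ)
    push_cast
    rw [neg_mul, mul_comm (φ : ℂ)] at h4
    linear_combination r * h4 - h3
  rw [h2]
  by_cases h0 : (r : ℂ) + Complex.exp (Complex.I * φ) = 0
  · rw [h1, h0]; simp
  · rw [div_mul_eq_div_div, div_self h0, one_div]

lemma exp_smul_KpF {R : ℝ} (hR : 0 < R) (ρ : ℝ) (μ : ℂ) (θ φ x : ℝ) :
    Real.exp x • KpF ρ μ R θ (Real.exp x) φ =
      ρ / (2 * π * Complex.I) * poleKernel (scaledKernel ρ (Real.log R + θ * Complex.I) μ)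
        (x + (φ - π : ℝ) * Complex.I) := by
  have hK := scaledKernel_eq_exp_mul_exp ρ (Real.log R + θ * Complex.I) μ (x - π * Complex.I) φ
  have hv : (x - π * Complex.I + φ * Complex.I : ℂ) = x + (φ - π : ℝ) * Complex.I := by
    push_cast; ring
  have h1 : 1 - Complex.exp (-(x + (φ - π : ℝ) * Complex.I)) =
      (Complex.exp x)⁻¹ * (Complex.exp x + Complex.exp (-(Complex.I * φ))) := by
    have : (-(x + (φ - π : ℝ) * Complex.I) : ℂ) = -x + (-(Complex.I * φ) + π * Complex.I) := by
      push_cast; ring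
    rw [this, Complex.exp_add, Complex.exp_add, Complex.exp_pi_mul_I, mul_add,
      inv_mul_cancel₀ (Complex.exp_ne_zero _), Complex.exp_neg]
    ring
  have hlog : Real.log (R * Real.exp x) = Real.log R + x := by
    rw [Real.log_mul hR.ne' (Real.exp_ne_zero x), Real.log_exp]
  rw [poleKernel, h1, mul_inv, inv_inv, ← hv, ← hK, KpF, etaF, mul_div_assoc, add_exp_I_div_eq,
    hlog, Complex.real_smul, Complex.ofReal_exp]
  have h2 : Complex.exp ((ρ : ℂ) * (1 - μ) * ((Real.log R + x : ℝ) + Complex.I * θ)) =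
      Complex.exp (ρ * (1 - μ) * (Real.log R + θ * Complex.I + (x - π * Complex.I))) *
        Complex.exp (Complex.I * (π * ρ * (1 - μ))) := by
    rw [← Complex.exp_add]
    push_cast
    ring_nf
  have h3 : (ρ : ℂ) * ((Real.log R + x : ℝ) + Complex.I * ((θ - π : ℝ) : ℂ)) =
      ρ * (Real.log R + θ * Complex.I + (x - π * Complex.I)) := by
    push_cast; ring
  have h4 := Complex.exp_ne_zero (Complex.I * (π * ρ * (1 - μ)))
  rw [h2, h3, mul_sub Complex.I, Complex.exp_sub]
  field_simp

lemma detour_eq {ε : ℝ} (hε0 : 0 < ε) (hε : ε < 1) (ψ : ℝ) :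
    detour ε ψ = Real.log (rP ε ψ) + phiP ε ψ (-2) * Complex.I := by
  have hre : (1 + ε * Complex.exp (ψ * Complex.I)).re = ε * Real.cos ψ + 1 := by
    simp [Complex.exp_ofReal_mul_I_re, add_comm]
  have him : (1 + ε * Complex.exp (ψ * Complex.I)).im = ε * Real.sin ψ := by
    simp [Complex.exp_ofReal_mul_I_im]
  have hpos := re_one_add_mul_exp_pos hε0 hε ψ
  have hnorm : ‖1 + ε * Complex.exp (ψ * Complex.I)‖ = rP ε ψ := by
    rw [Complex.norm_def, rP, Complex.normSq_apply, hre, him]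
    congr 1
    linear_combination ε ^ 2 * Real.sin_sq_add_cos_sq ψ
  have harg := abs_lt.1 (Complex.abs_arg_lt_pi_div_two_iff.2 (.inl hpos))
  have hphi : phiP ε ψ (-2) = (1 + ε * Complex.exp (ψ * Complex.I)).arg - 2 * π := by
    rw [phiP, ← hre, ← him, ← Complex.tan_arg, Real.arctan_tan harg.1 harg.2]
    push_cast
    ring
  rw [detour, Complex.log, hnorm, hphi]
  push_cast
  ring

lemma PpF_neg_two {R ε : ℝ} (hR : 0 < R) (hε0 : 0 < ε) (hε : ε < 1) (ρ : ℝ) (μ : ℂ) (θ ψ : ℝ) :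
    PpF ρ μ R θ ε ψ (-2) =
      ρ / (2 * π) * scaledKernel ρ (Real.log R + θ * Complex.I) μ (detour ε ψ) := by
  have hv := detour_eq hε0 hε ψ
  have hr : 0 < rP ε ψ := Real.sqrt_pos.2 <| by
    nlinarith [Real.neg_one_le_cos ψ]
  rw [hv, ← scaledKernel_eq_exp_mul_exp]
  have hexp : (rP ε ψ : ℂ) * Complex.exp (Complex.I * phiP ε ψ (-2)) - 1 =
      ε * Complex.exp (Complex.I * ψ) := by
    have := exp_detour hε0 hε ψ
    rw [hv, Complex.exp_add, ← Complex.ofReal_exp, Real.exp_log hr] at this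
    rw [mul_comm Complex.I, this, mul_comm Complex.I]
    ring
  have h1 := add_exp_I_div_eq (-rP ε ψ) (phiP ε ψ (-2))
  have h2 : ((rP ε ψ : ℂ) * Complex.exp (-(Complex.I * phiP ε ψ (-2))) - 1) /
      ((rP ε ψ ^ 2 - 2 * rP ε ψ * Real.cos (phiP ε ψ (-2)) + 1 : ℝ) : ℂ) =
      (ε * Complex.exp (Complex.I * ψ))⁻¹ := by
    have hnum : (rP ε ψ : ℂ) * Complex.exp (-(Complex.I * phiP ε ψ (-2))) - 1 =
        -Complex.exp (-(Complex.I * phiP ε ψ (-2))) *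
          ((-rP ε ψ : ℝ) + Complex.exp (Complex.I * phiP ε ψ (-2))) := by
      rw [mul_add, neg_mul _ (Complex.exp (Complex.I * _)), ← Complex.exp_add, neg_add_cancel,
        Complex.exp_zero]
      push_cast
      ring
    have hden : rP ε ψ ^ 2 - 2 * rP ε ψ * Real.cos (phiP ε ψ (-2)) + 1 =
        (-rP ε ψ) ^ 2 + 2 * (-rP ε ψ) * Real.cos (phiP ε ψ (-2)) + 1 := by ring
    rw [hnum, hden, mul_div_assoc, h1, ← hexp, Complex.exp_neg, ← inv_neg, ← mul_inv]
    congr 1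
    have := Complex.exp_ne_zero (Complex.I * phiP ε ψ (-2))
    push_cast
    field_simp
    ring
  rw [PpF, chiP, mul_div_assoc, h2, Real.log_mul hR.ne' hr.ne', mul_add Complex.I _ (ψ : ℂ),
    Complex.exp_add _ (Complex.I * ψ)]
  have h3 := Complex.exp_ne_zero (Complex.I * ψ)
  have h4 : (ε : ℂ) ≠ 0 := by exact_mod_cast hε0.ne'
  have h5 : (π : ℂ) ≠ 0 := by exact_mod_cast Real.pi_ne_zero
  have h6 : ((Real.log R + Real.log (rP ε ψ) : ℝ) : ℂ) + Complex.I * θ =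
    Real.log R + θ * Complex.I + Real.log (rP ε ψ) := by push_cast; ring
  rw [h6]
  push_cast
  field_simp

lemma setIntegral_image_exp (g : ℝ → ℂ) {t : Set ℝ} (ht : MeasurableSet t) :
    ∫ r in Real.exp '' t, g r = ∫ x in t, Real.exp x • g (Real.exp x) := by
  rw [integral_image_eq_integral_abs_deriv_smul ht
    (fun x _ ↦ (Real.hasDerivAt_exp x).hasDerivWithinAt) Real.exp_injective.injOn]
  simp only [abs_of_pos (Real.exp_pos _)]

lemma image_exp_Iic_log {d : ℝ} (hd : 0 < d) :
    Real.exp '' Set.Iic (Real.log d) = Set.Ioc 0 d := by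
  ext y
  constructor
  · rintro ⟨x, hx, rfl⟩
    exact ⟨Real.exp_pos x, (Real.le_log_iff_exp_le hd).1 hx⟩
  · rintro ⟨h0, hy⟩
    exact ⟨Real.log y, Real.log_le_log h0 hy, Real.exp_log h0⟩

/-- Representation "B", case 2 (Theorem 3, item 2): `1/2 < ρ ≤ 1`, `δ₁ρ = π`. -/
theorem mittagLeffler_repr_B_case2
    (ρ δ₂ R θ ε₁ : ℝ) (μ : ℂ)
    (hρl : 1 / 2 < ρ) (hρu : ρ ≤ 1) (hμ : μ.re < 1 + 1 / ρ)
    (hδ₂l : π / (2 * ρ) < δ₂) (hδ₂u : δ₂ < π)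
    (hR : 0 < R)
    (hθl : π / (2 * ρ) - δ₂ + π < θ) (hθu : θ < -(π / (2 * ρ)) + 2 * π)
    (hε₁l : 0 < ε₁) (hε₁u : ε₁ < 1) :
    ML ρ μ ((R : ℂ) * Complex.exp (Complex.I * (θ : ℂ))) =
      (∫ r in Set.Ioi (0 : ℝ), KpF ρ μ R θ r δ₂)
      - (∫ r in (0 : ℝ)..(1 - ε₁), KpF ρ μ R θ r (-π))
      - (∫ r in Set.Ioi (1 + ε₁), KpF ρ μ R θ r (-π))
      + ∫ ψ in (-(2 * π))..(-π), PpF ρ μ R θ ε₁ ψ (-2) := by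
  have hπ := Real.pi_pos
  have hρ : 0 < ρ := by linarith
  have hq : ρ * (π / (2 * ρ)) = π / 2 := by field_simp
  have hq0 : 0 < π / (2 * ρ) := by positivity
  set ℓ : ℂ := Real.log R + θ * Complex.I with hℓ
  have hℓim : ℓ.im = θ := by simp [hℓ]
  have hz : (R : ℂ) * Complex.exp (Complex.I * (θ : ℂ)) = Complex.exp ℓ := by
    rw [hℓ, Complex.exp_add, ← Complex.ofReal_exp, Real.exp_log hR, mul_comm Complex.I]
  have hθ1 : ρ * (π / (2 * ρ)) < ρ * θ := by gcongr; linarith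
  have hθ2 : ρ * θ < ρ * (-(π / (2 * ρ)) + 2 * π) := by gcongr
  have hθ3 : ρ * (π / (2 * ρ)) < ρ * (θ + (δ₂ - π)) := by gcongr; linarith
  have hθ4 : ρ * (θ + (δ₂ - π)) < ρ * (-(π / (2 * ρ)) + 2 * π) :=
    mul_lt_mul_of_pos_left (by linarith) hρ
  have hρπ : ρ * π ≤ π := mul_le_of_le_one_left hπ.le hρu
  have ha : ρ * (ℓ.im + -(2 * π)) ∈ Set.Ioo (-(3 * π / 2)) (-(π / 2)) := by
    rw [hℓim]; constructor <;> linarith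
  have hb : ρ * (ℓ.im + (δ₂ - π)) ∈ Set.Ioo (π / 2) (3 * π / 2) := by
    rw [hℓim]; constructor <;> linarith
  have hsum := (hasSum_mittagLeffler hρ ℓ μ (Real.log_pos (by linarith : 1 < 1 + ε₁)) ha hb).tsum_eq
  have hdeform := hankelIntegral_poleKernel_eq hρ ℓ hμ hε₁l hε₁u
    (b := δ₂ - π) (by linarith) (by linarith)
    (cos_neg_of_mem_uIcc_neg_pi ha Set.left_mem_uIcc) (cos_neg_of_mem_uIcc_pi hb Set.left_mem_uIcc)
  have hI0 : ∫ r in Set.Ioi (0 : ℝ), KpF ρ μ R θ r δ₂ = ρ / (2 * π * Complex.I) *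
      ∫ x : ℝ, poleKernel (scaledKernel ρ ℓ μ) (x + (δ₂ - π : ℝ) * Complex.I) := by
    rw [← Real.range_exp, ← Set.image_univ, setIntegral_image_exp _ MeasurableSet.univ,
      setIntegral_univ]
    simp only [exp_smul_KpF hR]
    rw [MeasureTheory.integral_const_mul]
  have hneg : -π - π = -(2 * π) := by ring
  have hI1 : ∫ r in (0 : ℝ)..(1 - ε₁), KpF ρ μ R θ r (-π) = ρ / (2 * π * Complex.I) *
      ∫ x in Set.Iic (Real.log (1 - ε₁)),
        poleKernel (scaledKernel ρ ℓ μ) (x + (-(2 * π) : ℝ) * Complex.I) := by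
    rw [integral_of_le (by linarith), ← image_exp_Iic_log (by linarith),
      setIntegral_image_exp _ measurableSet_Iic]
    simp only [exp_smul_KpF hR, hneg]
    rw [MeasureTheory.integral_const_mul]
  have hI2 : ∫ r in Set.Ioi (1 + ε₁), KpF ρ μ R θ r (-π) = ρ / (2 * π * Complex.I) *
      ∫ x in Set.Ioi (Real.log (1 + ε₁)),
        poleKernel (scaledKernel ρ ℓ μ) (x + (-(2 * π) : ℝ) * Complex.I) := by
    rw [← Real.exp_log (by linarith : 0 < 1 + ε₁), ← integral_comp_exp_Ioi]
    simp only [exp_smul_KpF hR, hneg, Real.log_exp]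
    rw [MeasureTheory.integral_const_mul]
  have hI3 : ∫ ψ in (-(2 * π))..(-π), PpF ρ μ R θ ε₁ ψ (-2) = ρ / (2 * π) *
      ∫ ψ in -(2 * π)..-π, scaledKernel ρ ℓ μ (detour ε₁ ψ) := by
    simp only [PpF_neg_two hR hε₁l hε₁u]
    rw [intervalIntegral.integral_const_mul]
  have h5 : (π : ℂ) ≠ 0 := by exact_mod_cast Real.pi_ne_zero
  have h6 := Complex.I_ne_zero
  rw [ML, hz, hsum, hI0, hI1, hI2, hI3]
  refine (congrArg (ρ / (2 * π * Complex.I) * ·) hdeform).trans ?_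
  field_simp
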